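/- Let V be a cyclically reduced word of length n, nonpower, and let S ⊆ {0,…,n-1}² be a finite set of pairs (i,j) each satisfying i ≠ j, v_i ≠ v_j, v̄_i ≠ v_{j-1}, and closed under no extra conditions. Fix p ≥ 4. Then the map (i,j,m) ↦ (cyclic class of V_i^m V_{i,j}, cyclic class of V_j^{p-m-1} V_{j,i}) restricted to pairs (i,j) ∈ S of 'symmetric type' (meaning (j,i) ∈ S as well, i.e., also v_j ≠ v̄_{i-1}) and m ∈ {0,…,p−1} is injective. -/

import Mathlib

/-- The word `v_i v_{i+1} … v_{i+len-1}` read off from the letter function `v`. -/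
def seg {A : Type*} (v : ℕ → A) (i len : ℕ) : List A :=
  (List.range len).map (fun t => v (i + t))

/-- Freely reduced: no letter is followed by its formal inverse. -/
def FRed {A : Type*} (bar : A → A) (w : List A) : Prop :=
  w.Chain' (fun x y => y ≠ bar x)

/-- Cyclically reduced: every rotation is freely reduced. -/
def CRed {A : Type*} (bar : A → A) (w : List A) : Prop :=
  ∀ r, FRed bar (w.rotate r)

/-- `p`-fold concatenation power of a word. -/
def pw {A : Type*} (w : List A) (m : ℕ) : List A := (List.replicate m w).flatten

/-- `w₂` is a cyclic rotation of `w₁`. -/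
def IsRot {A : Type*} (w₁ w₂ : List A) : Prop := ∃ r, w₂ = w₁.rotate r

/-- The cyclic class of `w` is not that of a proper power. -/
def Nonpower {A : Type*} (w : List A) : Prop :=
  ¬ ∃ (u : List A) (p : ℕ), 2 ≤ p ∧ IsRot (pw u p) w

theorem seg_append {A : Type*} (v : ℕ → A) (i a b : ℕ) :
    seg v i (a + b) = seg v i a ++ seg v (i + a) b := by
  simp [seg, List.range_add, Nat.add_assoc, Function.comp_def]

theorem seg_shift {A : Type*} {v : ℕ → A} {n : ℕ} (hper : ∀ t, v (t + n) = v t) (i b : ℕ) :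
    seg v (i + n) b = seg v i b := by
  unfold seg
  refine List.map_congr_left fun t _ => ?_
  rw [Nat.add_right_comm, hper]

theorem pw_seg_append {A : Type*} {v : ℕ → A} {n : ℕ} (hper : ∀ t, v (t + n) = v t)
    (i m d : ℕ) : pw (seg v i n) m ++ seg v i d = seg v i (m * n + d) := by
  induction m with
  | zero => simp [pw]
  | succ m ih =>
    have hpw : pw (seg v i n) (m + 1) = seg v i n ++ pw (seg v i n) m := by
      simp [pw, List.replicate_succ]
    rw [hpw, List.append_assoc, ih, ← seg_shift hper i (m * n + d), ← seg_append]
    congr 1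
    ring

theorem pw_seg {A : Type*} {v : ℕ → A} {n : ℕ} (hper : ∀ t, v (t + n) = v t)
    (i m : ℕ) : pw (seg v i n) m = seg v i (m * n) := by
  simpa [seg] using pw_seg_append hper i m 0

theorem IsRot.length_eq {A : Type*} {w₁ w₂ : List A} (h : IsRot w₁ w₂) :
    w₂.length = w₁.length := by
  obtain ⟨r, rfl⟩ := h
  exact List.length_rotate ..

theorem length_seg {A : Type*} (v : ℕ → A) (i L : ℕ) : (seg v i L).length = L := by
  simp [seg]

theorem IsRot.exists_shift {A : Type*} {v : ℕ → A} {i k L : ℕ} (hL : 0 < L)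
    (h : IsRot (seg v i L) (seg v k L)) :
    ∃ r < L, ∀ t < L, v (k + t) = v (i + (t + r) % L) := by
  obtain ⟨r, hr⟩ := h
  refine ⟨r % L, Nat.mod_lt _ hL, fun t ht => ?_⟩
  have key := congrArg (fun l : List A => l[t]?) hr
  simp only [List.getElem?_rotate (show t < (seg v i L).length by simpa [seg] using ht)] at key
  simpa [seg, ht, Nat.mod_lt _ hL] using key

theorem periodic_mul {A : Type*} {v : ℕ → A} {q : ℕ} (hq : ∀ t, v (t + q) = v t) (c t : ℕ) :
    v (t + q * c) = v t := by
  induction c with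
  | zero => simp
  | succ c ih => rw [Nat.mul_succ, ← Nat.add_assoc, hq, ih]

/-- A nonpower word of length `n` has no period shorter than `n`. -/
theorem Nonpower.le_period {A : Type*} {v : ℕ → A} {n : ℕ} (hn : 0 < n)
    (hper : ∀ t, v (t + n) = v t) (hnp : Nonpower (seg v 0 n)) {s : ℕ} (hs : 0 < s)
    (hsper : ∀ t, v (t + s) = v t) : n ≤ s := by
  classical
  have hex : ∃ q, 0 < q ∧ ∀ t, v (t + q) = v t := ⟨s, hs, hsper⟩
  obtain ⟨hq, hqper⟩ := Nat.find_spec hex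
  have hqs : Nat.find hex ≤ s := Nat.find_min' hex ⟨hs, hsper⟩
  have hmin : ∀ x, 0 < x → (∀ t, v (t + x) = v t) → Nat.find hex ≤ x :=
    fun x hx hxper => Nat.find_min' hex ⟨hx, hxper⟩
  generalize Nat.find hex = q at *
  have hmod : n % q = 0 := by
    by_contra hne
    refine absurd (Nat.mod_lt n hq) (not_lt.2 (hmin _ (Nat.pos_of_ne_zero hne) fun t => ?_))
    rw [← periodic_mul hqper (n / q) (t + n % q), Nat.add_assoc, Nat.mod_add_div, hper]
  obtain ⟨c, rfl⟩ := Nat.dvd_of_mod_eq_zero hmod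
  by_contra! hlt
  have hc : 2 ≤ c := by
    by_contra! hc
    interval_cases c <;> omega
  refine hnp ⟨seg v 0 q, c, hc, 0, ?_⟩
  rw [pw_seg hqper, List.rotate_zero, Nat.mul_comm]

theorem Nonpower.eq_of_shift_eq {A : Type*} {v : ℕ → A} {n : ℕ} (hn : 0 < n)
    (hper : ∀ t, v (t + n) = v t) (hnp : Nonpower (seg v 0 n)) {i k : ℕ} (hi : i < n)
    (hk : k < n) (heq : ∀ t < n, v (k + t) = v (i + t)) : i = k := by
  wlog hik : i ≤ k generalizing i k
  · exact (this hk hi (fun t ht => (heq t ht).symm) (by omega)).symm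
  have hmod : ∀ a t, v (a + t % n) = v (a + t) := fun a t => by
    conv_rhs => rw [← Nat.mod_add_div t n, ← Nat.add_assoc, periodic_mul hper]
  by_contra hne
  have hle := hnp.le_period hn hper (s := k - i) (by omega) fun t => by
    rw [← hper t, ← hper (t + (k - i)), show t + (k - i) + n = k + (t + (n - i)) by omega,
      show t + n = i + (t + (n - i)) by omega, ← hmod k, ← hmod i]
    exact heq _ (Nat.mod_lt _ hn)
  omega

theorem add_mod_period {A : Type*} {v : ℕ → A} {n : ℕ} (hper : ∀ t, v (t + n) = v t)
    {i j : ℕ} (hi : i < n) (hj : j < n) (c : ℕ) :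
    v (i + (c * n + (j + n - i) % n)) = v j := by
  rw [show i + (c * n + (j + n - i) % n) = i + (j + n - i) % n + n * c by ring,
    periodic_mul hper]
  rcases le_or_gt i j with hij | hij
  · rw [show j + n - i = j - i + n by omega, Nat.add_mod_right, Nat.mod_eq_of_lt (by omega)]
    congr 1
    omega
  · rw [Nat.mod_eq_of_lt (by omega), show i + (j + n - i) = j + n by omega, hper]

/-- Two rotations of the same cyclic word, each a run of period `n` of length at least `2 * n`
broken at its right end, start at the same letter of the nonpower word. -/
theorem start_eq_of_isRot {A : Type*} {v : ℕ → A} {n : ℕ} (hn : 0 < n)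
    (hper : ∀ t, v (t + n) = v t) (hnp : Nonpower (seg v 0 n)) {i k L : ℕ} (hi : i < n)
    (hk : k < n) (hL : 2 * n ≤ L) (hiL : v (i + L) ≠ v i) (hkL : v (k + L) ≠ v k)
    (hrot : IsRot (seg v i L) (seg v k L)) : i = k := by
  obtain ⟨r, hr, hshift⟩ := hrot.exists_shift (by omega)
  rcases Nat.eq_zero_or_pos r with rfl | hpos
  · refine hnp.eq_of_shift_eq hn hper hi hk fun t ht => ?_
    rw [hshift t (by omega), Nat.add_zero, Nat.mod_eq_of_lt (by omega)]
  rcases lt_or_ge r n with hrn | hrn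
  · have h₁ := hshift (L - n - r) (by omega)
    have h₂ := hshift (L - r) (by omega)
    rw [Nat.mod_eq_of_lt (by omega), ← hper, ← hper (i + _),
      show k + (L - n - r) + n = k + (L - r) by omega,
      show i + (L - n - r + r) + n = i + L by omega] at h₁
    rw [show L - r + r = L by omega, Nat.mod_self, Nat.add_zero] at h₂
    exact absurd (h₁.symm.trans h₂) hiL
  · have h₁ := hshift (L - n) (by omega)
    have h₂ := hshift 0 (by omega)
    rw [show L - n + r = r - n + L by omega, Nat.add_mod_right, Nat.mod_eq_of_lt (by omega),
      ← hper, ← hper (i + _), show k + (L - n) + n = k + L by omega,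
      show i + (r - n) + n = i + r by omega] at h₁
    rw [Nat.zero_add, Nat.mod_eq_of_lt hr, Nat.add_zero] at h₂
    exact absurd (h₁.trans h₂.symm) hkL

theorem eq_of_offset_eq {n i j h : ℕ} (hj : j < n) (hh : h < n) (hi : i < n)
    (heq : (j + n - i) % n = (h + n - i) % n) : j = h := by
  have hmod : j + n - i ≡ h + n - i [MOD n] := heq
  have hsum := hmod.add_right i
  rw [Nat.sub_add_cancel (by omega), Nat.sub_add_cancel (by omega)] at hsum
  simpa [Nat.ModEq, Nat.mod_eq_of_lt, hj, hh] using hsum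

/-- For `m ≥ 2`, the cyclic class of `V_i^m V_{i,j}` determines `(i, j, m)`. -/
theorem eq_of_isRot_pw_append {A : Type*} {v : ℕ → A} {n : ℕ} (hn : 0 < n)
    (hper : ∀ t, v (t + n) = v t) (hnp : Nonpower (seg v 0 n)) {i j k h m m' : ℕ}
    (hi : i < n) (hj : j < n) (hk : k < n) (hh : h < n) (hij : v i ≠ v j) (hkh : v k ≠ v h)
    (hm : 2 ≤ m)
    (hrot : IsRot (pw (seg v i n) m ++ seg v i ((j + n - i) % n))
      (pw (seg v k n) m' ++ seg v k ((h + n - k) % n))) :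
    i = k ∧ j = h ∧ m = m' := by
  rw [pw_seg_append hper, pw_seg_append hper] at hrot
  have hlen := hrot.length_eq
  rw [length_seg, length_seg] at hlen
  have hoff : (j + n - i) % n = (h + n - k) % n := by
    simpa [Nat.add_mod, Nat.mul_mod_left] using (congrArg (· % n) hlen).symm
  have hmm : m = m' := by
    rw [hoff] at hlen
    exact (Nat.eq_of_mul_eq_mul_right hn (Nat.add_right_cancel hlen)).symm
  have hiL := add_mod_period hper hi hj m
  have hkL := add_mod_period hper hk hh m'
  rw [hlen] at hkL hrot
  have hik : i = k := start_eq_of_isRot hn hper hnp hi hk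
    (Nat.le_add_right_of_le (Nat.mul_le_mul_right n hm)) (hiL ▸ hij.symm) (hkL ▸ hkh.symm) hrot
  subst hik
  exact ⟨rfl, eq_of_offset_eq hj hh hi hoff, hmm⟩

/-- For a nonpower cyclically reduced `V`, a set `S` of linked-type pairs,
and `p ≥ 4`, the map `(i,j,m) ↦ (class of V_i^m V_{i,j}, class of V_j^{p-m-1} V_{j,i})`
is injective on pairs of symmetric type (those with `(j,i) ∈ S` as well) and
`m ∈ {0,…,p−1}`; equality of both cyclic classes forces `(i,j,m) = (k,h,m')`. -/
theorem stmt13 {A : Type*} (bar : A → A) (hbar : ∀ x, bar (bar x) = x)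
    (v : ℕ → A) (n : ℕ) (hn : 0 < n)
    (hper : ∀ t, v (t + n) = v t)
    (hred : ∀ t, v (t + 1) ≠ bar (v t))
    (hnp : Nonpower (seg v 0 n))
    (S : Finset (ℕ × ℕ))
    (hS : ∀ x ∈ S, x.1 < n ∧ x.2 < n ∧ x.1 ≠ x.2 ∧ v x.1 ≠ v x.2 ∧
      bar (v x.1) ≠ v (x.2 + n - 1))
    (p : ℕ) (hp : 4 ≤ p)
    (i j k h m m' : ℕ)
    (hijS : (i, j) ∈ S) (hjiS : (j, i) ∈ S)
    (hkhS : (k, h) ∈ S) (hhkS : (h, k) ∈ S)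
    (hm : m < p) (hm' : m' < p)
    (hfst : IsRot (pw (seg v i n) m ++ seg v i ((j + n - i) % n))
                  (pw (seg v k n) m' ++ seg v k ((h + n - k) % n)))
    (hsnd : IsRot (pw (seg v j n) (p - m - 1) ++ seg v j ((i + n - j) % n))
                  (pw (seg v h n) (p - m' - 1) ++ seg v h ((k + n - h) % n))) :
    i = k ∧ j = h ∧ m = m' := by
  obtain ⟨hi, hj, -, hij, -⟩ := hS _ hijS
  obtain ⟨hk, hh, -, hkh, -⟩ := hS _ hkhS
  rcases le_or_gt 2 m with h2 | h2
  · exact eq_of_isRot_pw_append hn hper hnp hi hj hk hh hij hkh h2 hfst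
  · obtain ⟨hjh, hik, hmm⟩ := eq_of_isRot_pw_append hn hper hnp hj hi hh hk hij.symm hkh.symm
      (by omega) hsnd
    exact ⟨hik, hjh, by omega⟩
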